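/- Let E be a centrally orthocomplete pseudo-effect algebra, (cᵢ)_{i∈I} a family of pairwise disjoint central elements of E, d ∈ E, and set c := ⋁_{i∈I} cᵢ, e := ⋁_{i∈I}(d ∧ cᵢ), f := ⋁_{i∈I}(d∼ ∧ cᵢ). Then: (i) e ≤ d, f ≤ d∼, and c = e + f; (ii) if d ≤ c, then d = ⋁_{i∈I}(d ∧ cᵢ). -/

import Mathlib

namespace PEApaper

/-- The bare data of a partial-addition structure: a partial binary operation
(encoded via `Option`) together with constants `0` and `1`. -/
structure PartialStruct (E : Type) where
  padd : E → E → Option E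
  zero : E
  one : E

namespace PartialStruct

variable {E : Type}

/-- `a ≤ b` iff `a + c = b` for some `c`. -/
def le (P : PartialStruct E) (a b : E) : Prop := ∃ c, P.padd a c = some b

/-- `m` is the greatest lower bound (meet `a ∧ b`) of `a` and `b`. -/
def IsMeet (P : PartialStruct E) (a b m : E) : Prop :=
  P.le m a ∧ P.le m b ∧ ∀ x, P.le x a → P.le x b → P.le x m

/-- `j` is the least upper bound (join `a ∨ b`) of `a` and `b`. -/
def IsJoin (P : PartialStruct E) (a b j : E) : Prop :=
  P.le a j ∧ P.le b j ∧ ∀ x, P.le a x → P.le b x → P.le j x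

/-- `s` is the supremum of the set `S`. -/
def IsSup (P : PartialStruct E) (S : Set E) (s : E) : Prop :=
  (∀ x ∈ S, P.le x s) ∧ ∀ u, (∀ x ∈ S, P.le x u) → P.le s u

/-- Left-associated partial sum of a list, continuing from `acc`. -/
def IsSumFrom (P : PartialStruct E) : E → List E → E → Prop
  | acc, [], s => s = acc
  | acc, a :: l, s => ∃ t, P.padd acc a = some t ∧ IsSumFrom P t l s

/-- `s` is the (left-associated) orthosum `e₁ + e₂ + ⋯ + eₙ` of the list. -/
def IsSumList (P : PartialStruct E) (l : List E) (s : E) : Prop :=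
  match l with
  | [] => s = P.zero
  | a :: t => IsSumFrom P a t s

/-- `c` is a central element: there is a PEA-isomorphism
`f : E → E[0,c] × E[0,c∼]` with `f c = (c,0)` such that `f x = (x₁,x₂)`
implies `x = x₁ + x₂`.  The isomorphism onto the product of the two
interval pseudo-effect algebras is spelled out explicitly. -/
def IsCentral (P : PartialStruct E) (c : E) : Prop :=
  ∃ cs, P.padd c cs = some P.one ∧
    ∃ f : E → E × E,
      (∀ x, P.le (f x).1 c ∧ P.le (f x).2 cs) ∧
      Function.Injective f ∧
      (∀ y : E × E, P.le y.1 c → P.le y.2 cs → ∃ x, f x = y) ∧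
      f c = (c, P.zero) ∧
      f P.one = (c, cs) ∧
      (∀ x, P.padd (f x).1 (f x).2 = some x) ∧
      (∀ a b ab, P.padd a b = some ab →
        P.padd (f a).1 (f b).1 = some (f ab).1 ∧
        P.padd (f a).2 (f b).2 = some (f ab).2) ∧
      (∀ a b s t, P.padd (f a).1 (f b).1 = some s → P.le s c →
        P.padd (f a).2 (f b).2 = some t → P.le t cs →
        ∃ ab, P.padd a b = some ab)

/-- The center `Γ(E)`. -/
def center (P : PartialStruct E) : Set E := {c | P.IsCentral c}

/-- The central interval `Γ(E)[0,c] = Γ(E) ∩ E[0,c]`. -/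
def centerIntervalSet (P : PartialStruct E) (c : E) : Set E :=
  {x | P.IsCentral x ∧ P.le x c}

/-- A Γ-orthogonal family: one dominated elementwise by a pairwise
disjoint family of central elements. -/
def GammaOrthogonal (P : PartialStruct E) {I : Type} (e : I → E) : Prop :=
  ∃ c : I → E, (∀ i, P.IsCentral (c i)) ∧
    (∀ i j, i ≠ j → P.IsMeet (c i) (c j) P.zero) ∧
    ∀ i, P.le (e i) (c i)

/-- Centrally orthocomplete: every Γ-orthogonal family has a supremum. -/
def IsCOPEA (P : PartialStruct E) : Prop :=
  ∀ (I : Type) (e : I → E), P.GammaOrthogonal e → ∃ s, P.IsSup (Set.range e) s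

/-- `c` is the central cover of `e`: the smallest central element above `e`. -/
def IsCentralCover (P : PartialStruct E) (c e : E) : Prop :=
  P.IsCentral c ∧ P.le e c ∧ ∀ d, P.IsCentral d → P.le e d → P.le c d

/-- `[Q]`: the set of all suprema of Γ-orthogonal families of elements of `Q`. -/
def bra (P : PartialStruct E) (Q : Set E) : Set E :=
  {s | ∃ (I : Type) (e : I → E), (∀ i, e i ∈ Q) ∧ P.GammaOrthogonal e ∧
    P.IsSup (Set.range e) s}

/-- `Q^γ = {q ∧ c : q ∈ Q, c ∈ Γ(E)}`. -/
def gammaClosure (P : PartialStruct E) (Q : Set E) : Set E :=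
  {m | ∃ q ∈ Q, ∃ c, P.IsCentral c ∧ P.IsMeet q c m}

/-- `Q↓ = ⋃_{q ∈ Q} E[0,q]`. -/
def downSet (P : PartialStruct E) (Q : Set E) : Set E :=
  {e | ∃ q ∈ Q, P.le e q}

/-- `Q' = {e ∈ E : q ∧ e = 0 for all q ∈ Q}`. -/
def commutant (P : PartialStruct E) (Q : Set E) : Set E :=
  {e | ∀ q ∈ Q, P.IsMeet q e P.zero}

/-- A type-determining (TD) set: `K = [K] = K^γ`. -/
def IsTD (P : PartialStruct E) (K : Set E) : Prop :=
  P.bra K = K ∧ P.gammaClosure K = K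

/-- A strongly type-determining (STD) set: `K = [K] = K↓`. -/
def IsSTD (P : PartialStruct E) (K : Set E) : Prop :=
  P.bra K = K ∧ P.downSet K = K

/-- `c` is the type-cover of `K` (w.r.t. the central cover map `γ`):
the unique central element with `γK = Γ(E)[0,c]`. -/
def IsTypeCover (P : PartialStruct E) (γ : E → E) (K : Set E) (c : E) : Prop :=
  P.IsCentral c ∧ γ '' K = P.centerIntervalSet c

/-- An atom: a nonzero element with no proper nonzero subelement. -/
def IsAtom' (P : PartialStruct E) (a : E) : Prop :=
  a ≠ P.zero ∧ ∀ x, P.le x a → x = P.zero ∨ x = a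

end PartialStruct

/-- A PEA-isomorphism between two partial-addition structures: a bijective
morphism whose inverse is a morphism. -/
structure IsPEAIso {A B : Type} (P : PartialStruct A) (Q : PartialStruct B)
    (f : A → B) : Prop where
  bijective : Function.Bijective f
  map_one : f P.one = Q.one
  map_add : ∀ a b ab, P.padd a b = some ab → Q.padd (f a) (f b) = some (f ab)
  rev_add : ∀ a b s, Q.padd (f a) (f b) = some s → ∃ ab, P.padd a b = some ab

open scoped Classical in
/-- The (coordinatewise) product of a family of partial structures. -/
noncomputable def prodStruct {I : Type} {A : I → Type}
    (Ps : ∀ i, PartialStruct (A i)) : PartialStruct (∀ i, A i) where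
  padd a b :=
    if h : ∀ i, ∃ s, (Ps i).padd (a i) (b i) = some s
    then some fun i => Classical.choose (h i)
    else none
  zero := fun i => (Ps i).zero
  one := fun i => (Ps i).one

/-- A pseudo-effect algebra. -/
structure PEA (E : Type) extends PartialStruct E where
  assoc_def : ∀ a b c : E,
    (∃ ab, padd a b = some ab ∧ ∃ x, padd ab c = some x) ↔
    (∃ bc, padd b c = some bc ∧ ∃ y, padd a bc = some y)
  assoc_eq : ∀ a b c ab bc x y, padd a b = some ab → padd ab c = some x →
    padd b c = some bc → padd a bc = some y → x = y
  exu_right : ∀ a : E, ∃! d, padd a d = some one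
  exu_left : ∀ a : E, ∃! e, padd e a = some one
  shift : ∀ a b ab, padd a b = some ab →
    (∃ d, padd d a = some ab) ∧ (∃ e, padd b e = some ab)
  one_add : ∀ a x, padd one a = some x → a = zero
  add_one : ∀ a x, padd a one = some x → a = zero

namespace PEA

variable {E : Type} (P : PEA E)

/-- Shorthand for the underlying partial structure. -/
abbrev ps : PartialStruct E := P.toPartialStruct

theorem one_add_zero : P.padd P.one P.zero = some P.one := by
  obtain ⟨d, hd, -⟩ := P.exu_right P.one
  have h := P.one_add d P.one hd
  rwa [h] at hd

theorem zero_add_one : P.padd P.zero P.one = some P.one := by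
  obtain ⟨e, he, -⟩ := P.exu_left P.one
  have h := P.add_one e P.one he
  rwa [h] at he

theorem padd_zero (a : E) : P.padd a P.zero = some a := by
  obtain ⟨e, he, -⟩ := P.exu_left a
  have h1 : ∃ ab, P.padd e a = some ab ∧ ∃ x, P.padd ab P.zero = some x :=
    ⟨P.one, he, P.one, P.one_add_zero⟩
  obtain ⟨t, ht, y, hy⟩ := (P.assoc_def e a P.zero).mp h1
  have hxy : P.one = y :=
    P.assoc_eq e a P.zero P.one t P.one y he P.one_add_zero ht hy
  obtain ⟨d, hd, hu⟩ := P.exu_right e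
  have hta : t = a := by
    have h2 : t = d := hu t (by rw [← hxy] at hy; exact hy)
    have h3 : a = d := hu a he
    rw [h2, h3]
  rwa [hta] at ht

theorem zero_padd (a : E) : P.padd P.zero a = some a := by
  obtain ⟨d, hd, -⟩ := P.exu_right a
  have h1 : ∃ bc, P.padd a d = some bc ∧ ∃ y, P.padd P.zero bc = some y :=
    ⟨P.one, hd, P.one, P.zero_add_one⟩
  obtain ⟨t, ht, y, hy⟩ := (P.assoc_def P.zero a d).mpr h1
  have hxy : y = P.one :=
    P.assoc_eq P.zero a d t P.one y P.one ht hy hd P.zero_add_one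
  obtain ⟨e, he, hu⟩ := P.exu_left d
  have hta : t = a := by
    have h2 : t = e := hu t (by rw [hxy] at hy; exact hy)
    have h3 : a = e := hu a hd
    rw [h2, h3]
  rwa [hta] at ht

theorem zero_le (a : E) : P.ps.le P.zero a := ⟨a, P.zero_padd a⟩

theorem le_refl (a : E) : P.ps.le a a := ⟨P.zero, P.padd_zero a⟩

open scoped Classical in
/-- The interval pseudo-effect algebra `E[0,p]` as a partial structure on
the subtype `{x // x ≤ p}`; the sum is defined iff it is defined in `E`
and lies below `p`, and the unit is `p`. -/
noncomputable def intervalStruct (p : E) :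
    PartialStruct {x : E // P.ps.le x p} where
  padd a b := (P.padd a.1 b.1).bind fun s =>
    if h : P.ps.le s p then some ⟨s, h⟩ else none
  zero := ⟨P.zero, P.zero_le p⟩
  one := ⟨p, P.le_refl p⟩

end PEA

/-- The order relation of a complete Boolean algebra structure, made explicit. -/
def cbaLe {X : Type} (inst : CompleteBooleanAlgebra X) (a b : X) : Prop :=
  @LE.le X (by letI := inst; exact inferInstance) a b

end PEApaper

namespace PEApaper.PEA

variable {E : Type} (P : PEA E)

theorem exists_assoc_right {a b c ab x : E} (h : P.padd a b = some ab)
    (h' : P.padd ab c = some x) :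
    ∃ bc, P.padd b c = some bc ∧ P.padd a bc = some x := by
  obtain ⟨bc, hbc, y, hy⟩ := (P.assoc_def a b c).mp ⟨ab, h, x, h'⟩
  exact ⟨bc, hbc, P.assoc_eq _ _ _ _ _ _ _ h h' hbc hy ▸ hy⟩

theorem exists_assoc_left {a b c bc x : E} (h : P.padd b c = some bc)
    (h' : P.padd a bc = some x) :
    ∃ ab, P.padd a b = some ab ∧ P.padd ab c = some x := by
  obtain ⟨ab, hab, y, hy⟩ := (P.assoc_def a b c).mpr ⟨bc, h, x, h'⟩
  exact ⟨ab, hab, P.assoc_eq _ _ _ _ _ _ _ hab hy h h' ▸ hy⟩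

theorem padd_left_cancel {a b b' s : E} (h : P.padd a b = some s)
    (h' : P.padd a b' = some s) : b = b' := by
  obtain ⟨t, ht, -⟩ := P.exu_left s
  obtain ⟨u, hu, h1⟩ := P.exists_assoc_left h ht
  obtain ⟨u', hu', h2⟩ := P.exists_assoc_left h' ht
  obtain rfl : u = u' := Option.some.inj (hu.symm.trans hu')
  exact (P.exu_right u).unique h1 h2

theorem padd_right_cancel {a a' b s : E} (h : P.padd a b = some s)
    (h' : P.padd a' b = some s) : a = a' := by
  obtain ⟨t, ht, -⟩ := P.exu_right s
  obtain ⟨u, hu, h1⟩ := P.exists_assoc_right h ht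
  obtain ⟨u', hu', h2⟩ := P.exists_assoc_right h' ht
  obtain rfl : u = u' := Option.some.inj (hu.symm.trans hu')
  exact (P.exu_left u).unique h1 h2

theorem eq_zero_of_padd_eq_zero {a b : E} (h : P.padd a b = some P.zero) :
    a = P.zero ∧ b = P.zero := by
  obtain ⟨x, hx, -⟩ := P.exists_assoc_left h P.one_add_zero
  obtain rfl := P.one_add a x hx
  exact ⟨rfl, Option.some.inj ((P.zero_padd b).symm.trans h)⟩

theorem eq_zero_of_padd_eq_right {a b : E} (h : P.padd a b = some b) : a = P.zero :=
  P.padd_right_cancel h (P.zero_padd b)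

theorem eq_zero_of_padd_eq_left {a b : E} (h : P.padd a b = some a) : b = P.zero :=
  P.padd_left_cancel h (P.padd_zero a)

theorem le_of_padd_right {a b s : E} (h : P.padd a b = some s) : P.ps.le b s :=
  (P.shift a b s h).2

theorem exists_padd_left_of_le {a b : E} (h : P.ps.le a b) : ∃ c, P.padd c a = some b :=
  let ⟨c, hc⟩ := h
  (P.shift a c b hc).1

theorem le_trans {a b c : E} (h : P.ps.le a b) (h' : P.ps.le b c) : P.ps.le a c := by
  obtain ⟨x, hx⟩ := h
  obtain ⟨y, hy⟩ := h'
  obtain ⟨z, -, hz⟩ := P.exists_assoc_right hx hy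
  exact ⟨z, hz⟩

theorem le_antisymm {a b : E} (h : P.ps.le a b) (h' : P.ps.le b a) : a = b := by
  obtain ⟨x, hx⟩ := h
  obtain ⟨y, hy⟩ := h'
  obtain ⟨z, hz, h1⟩ := P.exists_assoc_right hx hy
  obtain rfl := P.eq_zero_of_padd_eq_left h1
  obtain ⟨rfl, -⟩ := P.eq_zero_of_padd_eq_zero hz
  exact Option.some.inj ((P.padd_zero a).symm.trans hx)

theorem eq_zero_of_le_zero {a : E} (h : P.ps.le a P.zero) : a = P.zero :=
  P.le_antisymm h (P.zero_le a)

theorem exists_padd_of_le {a a' b b' s : E} (ha : P.ps.le a a') (hb : P.ps.le b b')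
    (h : P.padd a' b' = some s) : ∃ t, P.padd a b = some t ∧ P.ps.le t s := by
  obtain ⟨x, hx⟩ := P.exists_padd_left_of_le ha
  obtain ⟨y, hy⟩ := hb
  obtain ⟨u, hu, hxu⟩ := P.exists_assoc_right hx h
  obtain ⟨t, ht, hty⟩ := P.exists_assoc_left hy hu
  exact ⟨t, ht, P.le_trans ⟨y, hty⟩ (P.le_of_padd_right hxu)⟩

theorem le_of_isSup_padd {S : Set E} (hS : S.Nonempty) {s b t v : E} (hs : P.ps.IsSup S s)
    (ht : P.padd s b = some t) (hv : ∀ x ∈ S, ∀ y, P.padd x b = some y → P.ps.le y v) :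
    P.ps.le t v := by
  obtain ⟨x₀, hx₀⟩ := hS
  have key : ∀ x ∈ S, ∃ w, P.padd w b = some v ∧ P.ps.le x w := by
    intro x hx
    obtain ⟨y, hy, -⟩ := P.exists_padd_of_le (hs.1 x hx) (P.le_refl b) ht
    obtain ⟨z, hz⟩ := P.exists_padd_left_of_le (hv x hx y hy)
    obtain ⟨w, hw, hwb⟩ := P.exists_assoc_left hy hz
    exact ⟨w, hwb, P.le_of_padd_right hw⟩
  obtain ⟨w, hw, -⟩ := key x₀ hx₀
  have hsw : P.ps.le s w := hs.2 w fun x hx => by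
    obtain ⟨w', hw', hx'⟩ := key x hx
    exact P.padd_right_cancel hw hw' ▸ hx'
  obtain ⟨t', ht', hle⟩ := P.exists_padd_of_le hsw (P.le_refl b) hw
  exact Option.some.inj (ht'.symm.trans ht) ▸ hle

theorem le_of_padd_isSup {S : Set E} (hS : S.Nonempty) {s a t v : E} (hs : P.ps.IsSup S s)
    (ht : P.padd a s = some t) (hv : ∀ x ∈ S, ∀ y, P.padd a x = some y → P.ps.le y v) :
    P.ps.le t v := by
  obtain ⟨x₀, hx₀⟩ := hS
  have key : ∀ x ∈ S, ∃ w, P.padd a w = some v ∧ P.ps.le x w := by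
    intro x hx
    obtain ⟨y, hy, -⟩ := P.exists_padd_of_le (P.le_refl a) (hs.1 x hx) ht
    obtain ⟨z, hz⟩ := hv x hx y hy
    obtain ⟨w, hw, hwb⟩ := P.exists_assoc_right hy hz
    exact ⟨w, hwb, z, hw⟩
  obtain ⟨w, hw, -⟩ := key x₀ hx₀
  have hsw : P.ps.le s w := hs.2 w fun x hx => by
    obtain ⟨w', hw', hx'⟩ := key x hx
    exact P.padd_left_cancel hw hw' ▸ hx'
  obtain ⟨t', ht', hle⟩ := P.exists_padd_of_le (P.le_refl a) hsw hw
  exact Option.some.inj (ht'.symm.trans ht) ▸ hle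

theorem isMeet_unique {a b m m' : E} (h : P.ps.IsMeet a b m) (h' : P.ps.IsMeet a b m') :
    m = m' :=
  P.le_antisymm (h'.2.2 m h.1 h.2.1) (h.2.2 m' h'.1 h'.2.1)

/-- The two coordinates of the decomposition along a central element: both are additive, and
the first one is the meet with that element. -/
theorem exists_coordinates {c : E} (hc : P.ps.IsCentral c) :
    ∃ p q : E → E, (∀ x, P.ps.IsMeet x c (p x)) ∧ p P.one = c ∧
      (∀ x, P.padd (p x) (q x) = some x) ∧
      (∀ a b s, P.padd a b = some s → P.padd (p a) (p b) = some (p s)) ∧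
      (∀ a b s, P.padd a b = some s → P.padd (q a) (q b) = some (q s)) := by
  obtain ⟨cs, -, f, hle, -, -, hfc, hf1, hsum, hadd, -⟩ := hc
  refine ⟨fun x => (f x).1, fun x => (f x).2, fun x => ⟨⟨_, hsum x⟩, (hle x).1, ?_⟩,
    by simp [hf1], hsum, fun a b s h => (hadd a b s h).1, fun a b s h => (hadd a b s h).2⟩
  rintro y ⟨z, hz⟩ ⟨w, hw⟩
  have h2 := (hadd y w c hw).2
  rw [hfc] at h2
  have h3 := hsum y
  rw [(P.eq_zero_of_padd_eq_zero h2).1] at h3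
  have h4 : (f y).1 = y := Option.some.inj ((P.padd_zero _).symm.trans h3)
  exact ⟨_, h4 ▸ (hadd y z x hz).1⟩

theorem isMeet_padd_isMeet_compl {c d ds m ms : E} (hc : P.ps.IsCentral c)
    (hds : P.padd d ds = some P.one) (hm : P.ps.IsMeet d c m) (hms : P.ps.IsMeet ds c ms) :
    P.padd m ms = some c := by
  obtain ⟨p, q, hp, hp1, -, hadd, -⟩ := P.exists_coordinates hc
  rw [P.isMeet_unique hm (hp d), P.isMeet_unique hms (hp ds), hadd _ _ _ hds, hp1]

theorem padd_le_of_disjoint {c c' a b s u : E} (hc : P.ps.IsCentral c)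
    (hcc' : P.ps.IsMeet c c' P.zero) (ha : P.ps.le a c) (hb : P.ps.le b c')
    (hs : P.padd a b = some s) (hau : P.ps.le a u) (hbu : P.ps.le b u) : P.ps.le s u := by
  obtain ⟨p, q, hp, -, hsum, -, hadd⟩ := P.exists_coordinates hc
  have hpb : p b = P.zero :=
    P.eq_zero_of_le_zero (hcc'.2.2 _ (hp b).2.1 (P.le_trans (hp b).1 hb))
  have hqb : q b = b := by
    have h := hsum b
    rw [hpb, P.zero_padd] at h
    exact Option.some.inj h
  obtain ⟨z, hz⟩ := hbu
  have hbq : P.ps.le b (q u) := ⟨q z, by have := hadd _ _ _ hz; rwa [hqb] at this⟩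
  obtain ⟨t, ht, hle⟩ := P.exists_padd_of_le ((hp u).2.2 a hau ha) hbq (hsum u)
  exact Option.some.inj (ht.symm.trans hs) ▸ hle

theorem isMeet_le_of_padd {c u h k x m : E} (hc : P.ps.IsCentral c) (hcu : P.ps.le c u)
    (huk : P.padd u k = some P.one) (hx : P.padd h k = some x) (hm : P.ps.IsMeet x c m) :
    P.ps.le m h := by
  obtain ⟨p, q, hp, -, -, hadd, -⟩ := P.exists_coordinates hc
  obtain ⟨s, hs, -⟩ := P.exists_padd_of_le hcu (P.le_refl k) huk
  have hpc : p c = c := P.isMeet_unique (hp c) ⟨P.le_refl c, P.le_refl c, fun _ h _ => h⟩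
  have hpk : p k = P.zero := by
    have h1 := hadd _ _ _ hs
    rw [hpc] at h1
    rw [P.le_antisymm (hp s).2.1 ⟨_, h1⟩] at h1
    exact P.eq_zero_of_padd_eq_left h1
  have h2 := hadd _ _ _ hx
  rw [hpk, P.padd_zero, ← P.isMeet_unique hm (hp x)] at h2
  exact Option.some.inj h2 ▸ (hp h).1

end PEApaper.PEA

open PEApaper PEApaper.PartialStruct in
/-- Corollary 4.6: in a COPEA, for a pairwise disjoint family `(cᵢ)` of
central elements and `d ∈ E`, with `c := ⋁ᵢ cᵢ`, `e := ⋁ᵢ (d ∧ cᵢ)`,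
`f := ⋁ᵢ (d∼ ∧ cᵢ)`:
(i) `e ≤ d`, `f ≤ d∼`, and `c = e + f`;
(ii) if `d ≤ c` then `d = ⋁ᵢ (d ∧ cᵢ)`. -/
theorem stmt7 {E I : Type} (P : PEA E) (hco : P.ps.IsCOPEA)
    (c : I → E) (hc : ∀ i, P.ps.IsCentral (c i))
    (hdisj : ∀ i j, i ≠ j → P.ps.IsMeet (c i) (c j) P.ps.zero)
    (d ds : E) (hds : P.ps.padd d ds = some P.ps.one)
    (m : I → E) (hm : ∀ i, P.ps.IsMeet d (c i) (m i))
    (ms : I → E) (hms : ∀ i, P.ps.IsMeet ds (c i) (ms i))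
    (cS e f : E) (hcS : P.ps.IsSup (Set.range c) cS)
    (he : P.ps.IsSup (Set.range m) e) (hf : P.ps.IsSup (Set.range ms) f) :
    (P.ps.le e d ∧ P.ps.le f ds ∧ P.ps.padd e f = some cS) ∧
    (P.ps.le d cS → d = e) := by
  have hed : P.ps.le e d := he.2 d (by rintro _ ⟨i, rfl⟩; exact (hm i).1)
  have hfds : P.ps.le f ds := hf.2 ds (by rintro _ ⟨i, rfl⟩; exact (hms i).1)
  obtain ⟨s, hs, -⟩ := P.exists_padd_of_le hed hfds hds
  have hmms i : P.padd (m i) (ms i) = some (c i) :=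
    P.isMeet_padd_isMeet_compl (hc i) hds (hm i) (hms i)
  have hcle i : P.ps.le (c i) cS := hcS.1 _ ⟨i, rfl⟩
  have hcs : P.ps.le cS s := hcS.2 s (by
    rintro _ ⟨i, rfl⟩
    obtain ⟨t, ht, hle⟩ := P.exists_padd_of_le (he.1 _ ⟨i, rfl⟩) (hf.1 _ ⟨i, rfl⟩) hs
    exact Option.some.inj (ht.symm.trans (hmms i)) ▸ hle)
  have hsc : P.ps.le s cS := by
    rcases isEmpty_or_nonempty I with hI | hI
    · have hz : ∀ (g : I → E) (x : E), P.ps.IsSup (Set.range g) x → x = P.zero :=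
        fun g x hx => P.eq_zero_of_le_zero (hx.2 _ (by rintro _ ⟨i, -⟩; exact hI.elim i))
      rw [hz m e he, hz ms f hf, P.zero_padd] at hs
      exact Option.some.inj hs ▸ P.zero_le cS
    · refine P.le_of_isSup_padd (Set.range_nonempty m) he hs ?_
      rintro _ ⟨i, rfl⟩ y hy
      refine P.le_of_padd_isSup (Set.range_nonempty ms) hf hy ?_
      rintro _ ⟨j, rfl⟩ z hz
      by_cases hij : i = j
      · subst hij
        exact Option.some.inj ((hmms i).symm.trans hz) ▸ hcle i
      · exact P.padd_le_of_disjoint (hc i) (hdisj i j hij) (hm i).2.1 (hms j).2.1 hz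
          (P.le_trans (hm i).2.1 (hcle i)) (P.le_trans (hms j).2.1 (hcle j))
  obtain rfl := P.le_antisymm hcs hsc
  refine ⟨⟨hed, hfds, hs⟩, fun ⟨h, hh⟩ => ?_⟩
  obtain ⟨k, hk, -⟩ := P.exu_right cS
  obtain ⟨x, hx, hdx⟩ := P.exists_assoc_right hh hk
  obtain rfl := P.padd_left_cancel hdx hds
  have hfh : P.ps.le f h := hf.2 h (by
    rintro _ ⟨i, rfl⟩
    exact P.isMeet_le_of_padd (hc i) (hcle i) hk hx (hms i))
  obtain ⟨g, hg⟩ := hed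
  obtain ⟨w, hw, hew⟩ := P.exists_assoc_right hg hh
  obtain rfl := P.padd_left_cancel hew hs
  obtain rfl := P.le_antisymm hfh (P.le_of_padd_right hw)
  obtain rfl := P.eq_zero_of_padd_eq_right hw
  exact Option.some.inj (hg.symm.trans (P.padd_zero e))
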